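/- Let D ⊂ ℂ^n be a bounded balanced domain, i.e. a bounded nonempty open set such that λ·z ∈ D for every z ∈ D and every complex number λ with |λ| ≤ 1. If f is an automorphism of D whose fixed point set is discrete in D, then Fix(f) is a finite set. -/

import Mathlib

open Set Metric Filter Topology

noncomputable section

/-- `ℂ^n` with the Euclidean norm. -/
abbrev CSpace (n : ℕ) := EuclideanSpace ℂ (Fin n)

/-- `f` is an automorphism of the set `D`: a holomorphic bijection of `D` onto
itself with a holomorphic inverse. -/
def AutOn {n : ℕ} (D : Set (CSpace n)) (f : CSpace n → CSpace n) : Prop :=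
  DifferentiableOn ℂ f D ∧ Set.BijOn f D D ∧
  ∃ g : CSpace n → CSpace n, DifferentiableOn ℂ g D ∧ Set.BijOn g D D ∧
    (∀ z ∈ D, g (f z) = z) ∧ (∀ z ∈ D, f (g z) = z)

/-- The fixed point set of `f` in `D`. -/
def FixOn {n : ℕ} (D : Set (CSpace n)) (f : CSpace n → CSpace n) : Set (CSpace n) :=
  {z ∈ D | f z = z}

/-- Every point of `S` is isolated in `S`. -/
def DiscreteIn {n : ℕ} (S : Set (CSpace n)) : Prop :=
  ∀ z ∈ S, ∃ ε > 0, ∀ w ∈ S, w ≠ z → ε ≤ dist w z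

/-- `f` extends holomorphically beyond the boundary of `D`. -/
def ExtendsHolo {n : ℕ} (D : Set (CSpace n)) (f : CSpace n → CSpace n) : Prop :=
  ∃ U : Set (CSpace n), IsOpen U ∧ closure D ⊆ U ∧
    ∃ F : CSpace n → CSpace n, DifferentiableOn ℂ F U ∧ Set.EqOn F f D

/-- `H` is a compact subgroup of the automorphism group of `D`. -/
def IsCompactAutGroup {n : ℕ} (D : Set (CSpace n))
    (H : Set (CSpace n → CSpace n)) : Prop :=
  (∀ f ∈ H, AutOn D f) ∧
  (∃ e ∈ H, ∀ z ∈ D, e z = z) ∧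
  (∀ f ∈ H, ∀ g ∈ H, ∃ h ∈ H, ∀ z ∈ D, h z = f (g z)) ∧
  (∀ f ∈ H, ∃ g ∈ H, (∀ z ∈ D, g (f z) = z) ∧ (∀ z ∈ D, f (g z) = z)) ∧
  (∀ u : ℕ → (CSpace n → CSpace n), (∀ k, u k ∈ H) →
    ∃ φ : ℕ → ℕ, StrictMono φ ∧ ∃ f ∈ H, ∀ K : Set (CSpace n), K ⊆ D → IsCompact K →
      TendstoUniformlyOn (fun k => u (φ k)) f Filter.atTop K)
section Holomorphic

variable {E F : Type*} [NormedAddCommGroup E] [NormedSpace ℂ E]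
  [NormedAddCommGroup F] [NormedSpace ℂ F]

/-- Cauchy estimate for a bounded holomorphic map on a ball. -/
lemma norm_fderiv_le_of_norm_le {g : E → F} {a : E} {r M : ℝ} (hr : 0 < r)
    (hg : DifferentiableOn ℂ g (ball a r)) (hM : ∀ z ∈ ball a r, ‖g z‖ ≤ M) :
    ‖fderiv ℂ g a‖ ≤ 2 * M / r := by
  refine Complex.norm_fderiv_le_div_of_mapsTo_ball hg (fun z hz => ?_) hr
  rw [mem_closedBall, dist_eq_norm]
  linarith [norm_sub_le (g z) (g a), hM z hz, hM a (mem_ball_self hr)]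

/-- A bounded holomorphic map on a ball is Lipschitz on the concentric ball of half the radius. -/
lemma norm_sub_le_of_norm_le {g : E → F} {a x y : E} {r M : ℝ}
    (hg : DifferentiableOn ℂ g (ball a (2 * r))) (hM : ∀ z ∈ ball a (2 * r), ‖g z‖ ≤ M)
    (hx : x ∈ ball a r) (hy : y ∈ ball a r) :
    ‖g x - g y‖ ≤ 2 * M / r * ‖x - y‖ := by
  have hr : 0 < r := pos_of_mem_ball hx
  let _ : NormedSpace ℝ E := NormedSpace.restrictScalars ℝ ℂ E
  have hsub : ∀ z ∈ ball a r, ball z r ⊆ ball a (2 * r) := fun z hz =>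
    ball_subset_ball' (by rw [mem_ball] at hz; linarith)
  refine (convex_ball a r).norm_image_sub_le_of_norm_fderiv_le (𝕜 := ℂ) (fun z hz => ?_)
    (fun z hz => ?_) hy hx
  · exact hg.differentiableAt (isOpen_ball.mem_nhds (hsub z hz (mem_ball_self hr)))
  · exact norm_fderiv_le_of_norm_le hr (hg.mono (hsub z hz)) fun w hw => hM w (hsub z hz hw)

/-- Quantitative strict differentiability of a bounded holomorphic map. -/
lemma norm_sub_sub_fderiv_le_of_norm_le {g : E → F} {a x y : E} {r δ M : ℝ}
    (hg : DifferentiableOn ℂ g (ball a (2 * r))) (hM : ∀ z ∈ ball a (2 * r), ‖g z‖ ≤ M)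
    (hδ : δ < r) (hx : x ∈ ball a δ) (hy : y ∈ ball a δ) :
    ‖g x - g y - fderiv ℂ g a (x - y)‖ ≤ 4 * M / r ^ 2 * δ * ‖x - y‖ := by
  have hδ0 : 0 < δ := pos_of_mem_ball hx
  have hr : 0 < r := hδ0.trans hδ
  have hM0 : 0 ≤ M := (norm_nonneg _).trans (hM a (mem_ball_self (by linarith)))
  have hρ : 1 < r / δ := (one_lt_div hδ0).2 hδ
  have hga : DifferentiableAt ℂ g a :=
    hg.differentiableAt (ball_mem_nhds a (by linarith))
  have hline : ∀ z ∈ ball a δ, ∀ c ∈ ball (0 : ℂ) (r / δ), a + c • (z - a) ∈ ball a r := by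
    intro z hz c hc
    rw [mem_ball_zero_iff, lt_div_iff₀ hδ0] at hc
    rw [mem_ball, dist_eq_norm] at hz
    rw [mem_ball, dist_eq_norm, add_sub_cancel_left, norm_smul]
    exact (mul_le_mul_of_nonneg_left hz.le (norm_nonneg c)).trans_lt hc
  have hA : ‖fderiv ℂ g a‖ ≤ 2 * M / r := by
    refine norm_fderiv_le_of_norm_le hr (hg.mono (ball_subset_ball (by linarith))) fun z hz => ?_
    exact hM z (ball_subset_ball (by linarith) hz)
  set h : ℂ → F := fun c =>
    g (a + c • (x - a)) - g (a + c • (y - a)) - c • fderiv ℂ g a (x - y) with hh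
  have h0 : h 0 = 0 := by simp [hh]
  have hdiff : ∀ z ∈ ball a δ,
      DifferentiableOn ℂ (fun c : ℂ => g (a + c • (z - a))) (ball 0 (r / δ)) := fun z hz =>
    hg.comp (by fun_prop) fun c hc => ball_subset_ball (by linarith) (hline z hz c hc)
  have hd : DifferentiableOn ℂ h (ball 0 (r / δ)) :=
    ((hdiff x hx).sub (hdiff y hy)).sub (by fun_prop)
  have hderiv : ∀ z : E,
      HasDerivAt (fun c : ℂ => g (a + c • (z - a))) (fderiv ℂ g a (z - a)) 0 := by
    intro z
    have h1 : HasDerivAt (fun c : ℂ => a + c • (z - a)) (z - a) 0 := by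
      simpa using ((hasDerivAt_id (0 : ℂ)).smul_const (z - a)).const_add a
    refine HasFDerivAt.comp_hasDerivAt (0 : ℂ) ?_ h1
    simpa using hga.hasFDerivAt
  have hh0 : HasDerivAt h 0 0 := by
    have := ((hderiv x).sub (hderiv y)).sub
      ((hasDerivAt_id (0 : ℂ)).smul_const (fderiv ℂ g a (x - y)))
    rwa [← map_sub, one_smul, ← map_sub, sub_sub_sub_cancel_right, sub_self, map_zero] at this
  have hmaps : MapsTo h (ball 0 (r / δ))
      (closedBall (h 0) (4 * M / r * (r / δ) * ‖x - y‖)) := by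
    intro c hc
    have h1 := norm_sub_le_of_norm_le hg hM (hline x hx c hc) (hline y hy c hc)
    rw [add_sub_add_left_eq_sub, ← smul_sub, sub_sub_sub_cancel_right, norm_smul] at h1
    have h2 : ‖c • fderiv ℂ g a (x - y)‖ ≤ ‖c‖ * (2 * M / r * ‖x - y‖) := by
      rw [norm_smul]
      gcongr
      exact (fderiv ℂ g a).le_of_opNorm_le hA _
    have hc' : ‖c‖ ≤ r / δ := (mem_ball_zero_iff.1 hc).le
    rw [h0, mem_closedBall_zero_iff]
    calc ‖h c‖ ≤ 2 * M / r * (‖c‖ * ‖x - y‖) + ‖c‖ * (2 * M / r * ‖x - y‖) :=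
          (norm_sub_le _ _).trans (add_le_add h1 h2)
      _ = 4 * M / r * ‖c‖ * ‖x - y‖ := by ring
      _ ≤ _ := by gcongr
  have key := Complex.dist_le_mul_div_pow_of_mapsTo_ball_of_isLittleO (n := 1) (z := 1) hd hmaps
    (by simpa [h0] using hh0.isLittleO.norm_right) (by simpa using hρ)
  rw [h0, dist_zero_right] at key
  have h1 : h 1 = g x - g y - fderiv ℂ g a (x - y) := by simp [hh]
  rw [h1] at key
  refine key.trans_eq ?_
  simp
  field_simp

lemma DifferentiableOn.hasStrictFDerivAt_of_norm_le {g : E → F} {D : Set E} {a : E} {M : ℝ}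
    (hD : IsOpen D) (ha : a ∈ D) (hg : DifferentiableOn ℂ g D) (hM : ∀ z ∈ D, ‖g z‖ ≤ M) :
    HasStrictFDerivAt g (fderiv ℂ g a) a := by
  obtain ⟨s, hs, hsD⟩ := Metric.isOpen_iff.1 hD a ha
  obtain ⟨r, rfl⟩ : ∃ r, s = 2 * r := ⟨s / 2, by ring⟩
  have hr : 0 < r := by linarith
  have hM0 : 0 ≤ M := (norm_nonneg _).trans (hM a ha)
  rw [hasStrictFDerivAt_iff_isLittleO, Asymptotics.isLittleO_iff]
  intro c hc
  obtain ⟨δ, hδ0, hδr, hδc⟩ : ∃ δ, 0 < δ ∧ δ < r ∧ 4 * M / r ^ 2 * δ ≤ c := by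
    have : Tendsto (fun δ : ℝ => 4 * M / r ^ 2 * δ) (𝓝[>] 0) (𝓝 0) := by
      have : Tendsto (fun δ : ℝ => 4 * M / r ^ 2 * δ) (𝓝 0) (𝓝 (4 * M / r ^ 2 * 0)) :=
        tendsto_id.const_mul _
      rw [mul_zero] at this
      exact this.mono_left nhdsWithin_le_nhds
    obtain ⟨δ, h1, h2, h3⟩ := ((this.eventually (ge_mem_nhds hc)).and
      (Ioo_mem_nhdsGT hr)).exists
    exact ⟨δ, h2, h3, h1⟩
  filter_upwards [prod_mem_nhds (ball_mem_nhds a hδ0) (ball_mem_nhds a hδ0)] with p hp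
  refine (norm_sub_sub_fderiv_le_of_norm_le (hg.mono hsD) (fun z hz => hM z (hsD hz)) hδr
    hp.1 hp.2).trans ?_
  gcongr

/-- Near a fixed point of a self-map of a bounded set, a point that is displaced
along the kernel of `fderiv ℂ f a - 1` is itself fixed. -/
lemma exists_ball_fixed_of_fderiv_sub {D : Set E} {f : E → E} {a : E} {M : ℝ}
    (hD : IsOpen D) (hM : ∀ z ∈ D, ‖z‖ ≤ M) (hf : DifferentiableOn ℂ f D) (hmaps : MapsTo f D D)
    (ha : a ∈ D) (hfa : f a = a) :
    ∃ δ > 0, ∀ z ∈ ball a δ, f z ∈ ball a δ →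
      fderiv ℂ f a (f z - z) = f z - z → f z = z := by
  obtain ⟨s, hs, hsD⟩ := Metric.isOpen_iff.1 hD a ha
  obtain ⟨r, rfl⟩ : ∃ r, s = 2 * r := ⟨s / 2, by ring⟩
  have hr : 0 < r := by linarith
  have hM0 : 0 ≤ M := (norm_nonneg _).trans (hM a ha)
  have hA := (hf.differentiableAt (hD.mem_nhds ha)).hasFDerivAt
  refine ⟨min (r / 2) (r ^ 2 / (8 * (M + 1))), by positivity, fun z hz hfz hker => ?_⟩
  set δ := min (r / 2) (r ^ 2 / (8 * (M + 1)))
  have hδr : δ < r := (min_le_left _ _).trans_lt (by linarith)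
  have hδ : 4 * M / r ^ 2 * δ ≤ 1 / 2 := by
    have h1 : δ ≤ r ^ 2 / (8 * (M + 1)) := min_le_right _ _
    calc 4 * M / r ^ 2 * δ ≤ 4 * M / r ^ 2 * (r ^ 2 / (8 * (M + 1))) := by gcongr
      _ = M / (M + 1) * (1 / 2) := by field_simp; ring
      _ ≤ 1 * (1 / 2) := by
        gcongr
        rw [div_le_one (by linarith)]
        linarith
      _ = 1 / 2 := one_mul _
  have hzD : z ∈ D := hsD (ball_subset_ball (by linarith) hz)
  set w := f z - z
  have hpow : ∀ k : ℕ, (fderiv ℂ f a ^ k) w = w := by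
    intro k
    induction k with
    | zero => simp
    | succ k ih => rw [pow_succ, mul_apply_eq_comp, hker, ih]
  have hstep : ∀ k : ℕ, ‖f^[k + 1] z - f^[k] z - w‖ ≤ 1 / 2 * ‖w‖ := by
    intro k
    have h1 := norm_sub_sub_fderiv_le_of_norm_le ((hf.iterate hmaps k).mono hsD)
      (fun y hy => hM _ (hmaps.iterate k (hsD hy))) hδr hfz hz
    rw [(hA.iterate hfa k).fderiv, hpow, ← Function.iterate_succ_apply] at h1
    exact h1.trans (by gcongr)
  have hsum : ∀ N : ℕ, ‖f^[N] z - z - N • w‖ ≤ N * (1 / 2 * ‖w‖) := by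
    intro N
    induction N with
    | zero => simp
    | succ N ih =>
      calc ‖f^[N + 1] z - z - (N + 1) • w‖
          = ‖(f^[N + 1] z - f^[N] z - w) + (f^[N] z - z - N • w)‖ := by
            rw [add_smul, one_smul]; congr 1; abel
        _ ≤ 1 / 2 * ‖w‖ + N * (1 / 2 * ‖w‖) := (norm_add_le _ _).trans (add_le_add (hstep N) ih)
        _ = _ := by push_cast; ring
  have hbound : ∀ N : ℕ, N * ‖w‖ ≤ 4 * M := by
    intro N
    have h1 : ‖N • w‖ = N * ‖w‖ := by
      rw [← Nat.cast_smul_eq_nsmul ℂ, norm_smul, Complex.norm_natCast]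
    have h2 : ‖N • w‖ ≤ ‖f^[N] z - z‖ + ‖f^[N] z - z - N • w‖ := by
      simpa using norm_sub_le (f^[N] z - z) (f^[N] z - z - N • w)
    linarith [hsum N, norm_sub_le (f^[N] z) z, hM _ hzD, hM _ (hmaps.iterate N hzD)]
  by_contra hne
  have hpos : 0 < ‖w‖ := norm_pos_iff.2 (sub_ne_zero.2 hne)
  obtain ⟨N, hN⟩ := exists_nat_gt (4 * M / ‖w‖)
  rw [div_lt_iff₀ hpos] at hN
  linarith [hbound N]

/-- The derivative at a fixed point of a holomorphic self-map of a bounded open set has no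
nontrivial Jordan block with eigenvalue `1`. -/
lemma disjoint_ker_range_fderiv_sub_one {D : Set E} {f : E → E} {a : E} {M : ℝ}
    (hD : IsOpen D) (hM : ∀ z ∈ D, ‖z‖ ≤ M) (hf : DifferentiableOn ℂ f D) (hmaps : MapsTo f D D)
    (ha : a ∈ D) (hfa : f a = a) :
    Disjoint (LinearMap.ker ((fderiv ℂ f a : E →L[ℂ] E) - 1 : E →L[ℂ] E).toLinearMap)
      (LinearMap.range ((fderiv ℂ f a : E →L[ℂ] E) - 1 : E →L[ℂ] E).toLinearMap) := by
  obtain ⟨r, hr, hrD⟩ := Metric.isOpen_iff.1 hD a ha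
  have hA := (hf.differentiableAt (hD.mem_nhds ha)).hasFDerivAt
  set A := fderiv ℂ f a
  rw [Submodule.disjoint_def]
  rintro v hv ⟨u, hu⟩
  replace hv : A v = v := sub_eq_zero.1 hv
  replace hu : A u = u + v := by
    rw [← hu]
    simp
  have hpow : ∀ k : ℕ, (A ^ k) u = u + k • v := by
    intro k
    induction k with
    | zero => simp
    | succ k ih =>
      rw [pow_succ', mul_apply_eq_comp, ih, map_add, map_nsmul, hu, hv, add_smul,
        one_smul]
      abel
  have hbound : ∀ k : ℕ, k * ‖v‖ ≤ (2 * M / r + 1) * ‖u‖ := by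
    intro k
    have h1 : ‖A ^ k‖ ≤ 2 * M / r := by
      rw [← (hA.iterate hfa k).fderiv]
      exact norm_fderiv_le_of_norm_le hr ((hf.iterate hmaps k).mono hrD)
        fun y hy => hM _ (hmaps.iterate k (hrD hy))
    have h2 := (A ^ k).le_of_opNorm_le h1 u
    have h3 : ‖k • v‖ = k * ‖v‖ := by
      rw [← Nat.cast_smul_eq_nsmul ℂ, norm_smul, Complex.norm_natCast]
    have h4 : ‖k • v‖ ≤ ‖(A ^ k) u‖ + ‖u‖ := by
      rw [hpow]
      simpa using norm_sub_le (u + k • v) u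
    linarith
  by_contra hne
  have hpos : 0 < ‖v‖ := norm_pos_iff.2 hne
  obtain ⟨N, hN⟩ := exists_nat_gt ((2 * M / r + 1) * ‖u‖ / ‖v‖)
  rw [div_lt_iff₀ hpos] at hN
  linarith [hbound N]

/-- If `1` is an eigenvalue of the derivative at a fixed point of a holomorphic self-map of a
bounded open set, then that point is an accumulation point of the set of fixed points. -/
lemma frequently_fixed_of_fderiv_apply_eq [FiniteDimensional ℂ E] {D : Set E} {f : E → E} {a v : E}
    {M : ℝ} (hD : IsOpen D) (hM : ∀ z ∈ D, ‖z‖ ≤ M) (hf : DifferentiableOn ℂ f D)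
    (hmaps : MapsTo f D D) (ha : a ∈ D) (hfa : f a = a) (hv0 : v ≠ 0)
    (hv : fderiv ℂ f a v = v) :
    ∃ᶠ z in 𝓝[≠] a, f z = z := by
  have : CompleteSpace E := FiniteDimensional.complete ℂ E
  obtain ⟨δ, hδ, hfix⟩ := exists_ball_fixed_of_fderiv_sub hD hM hf hmaps ha hfa
  have hdisj := disjoint_ker_range_fderiv_sub_one hD hM hf hmaps ha hfa
  have hstrict := hf.hasStrictFDerivAt_of_norm_le hD ha fun z hz => hM _ (hmaps hz)
  set A := fderiv ℂ f a
  have hcompl := (Submodule.isCompl_iff_disjoint _ _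
    (by rw [add_comm, LinearMap.finrank_range_add_finrank_ker])).2 hdisj
  set P : E →L[ℂ] E := LinearMap.toContinuousLinearMap
    (Submodule.projection _ _ hcompl)
  have hPker : ∀ u, A u = u → P u = u := fun u hu =>
    Submodule.projection_apply_of_mem_left hcompl (by simp [hu])
  have hPmem : ∀ u, A (P u) = P u := fun u =>
    sub_eq_zero.1 (Submodule.projection_apply_mem hcompl u)
  have hPrange : ∀ u, P (A u - u) = 0 := fun u =>
    Submodule.projection_apply_of_mem_right hcompl ⟨u, by simp⟩
  set Φ : E → E := fun z => P (z - a) + ((z - f z) - P (z - f z)) with hΦ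
  have hΦ' : HasStrictFDerivAt Φ (P + ((1 - A) - P ∘L (1 - A))) a := by
    have h1 : HasStrictFDerivAt (fun z => z - f z) (1 - A) a := (hasStrictFDerivAt_id a).sub hstrict
    exact (P.hasStrictFDerivAt.comp a ((hasStrictFDerivAt_id a).sub_const a)).add
      (h1.sub (P.hasStrictFDerivAt.comp a h1))
  have hsurj : (P + ((1 - A) - P ∘L (1 - A)) : E →L[ℂ] E).range = ⊤ := by
    rw [LinearMap.range_eq_top]
    refine LinearMap.injective_iff_surjective.1 ((injective_iff_map_eq_zero _).2 fun u hu => ?_)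
    replace hu : P u + ((u - A u) - P (u - A u)) = 0 := by simpa using hu
    have h1 : P (u - A u) = 0 := by rw [← neg_sub, map_neg, hPrange, neg_zero]
    rw [h1, sub_zero] at hu
    have h2 : P u = 0 := by
      have := congrArg P hu
      rwa [map_add, h1, map_zero, add_zero, hPker _ (hPmem u)] at this
    rw [h2, zero_add, sub_eq_zero] at hu
    rw [← hPker u hu.symm, h2]
  have hΦa : Φ a = 0 := by simp [hΦ, hfa]
  have hmap := hΦ'.map_nhds_eq_of_surj hsurj
  rw [hΦa] at hmap
  intro hev
  rw [eventually_nhdsWithin_iff] at hev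
  have hfcont : Tendsto f (𝓝 a) (𝓝 a) := by
    simpa [hfa] using hstrict.continuousAt.tendsto
  have hall : ∀ᶠ z in 𝓝 a, (z ≠ a → f z ≠ z) ∧ z ∈ ball a δ ∧ f z ∈ ball a δ :=
    hev.and (Filter.Eventually.and (ball_mem_nhds a hδ)
      (hfcont.eventually (ball_mem_nhds a hδ)))
  have himg := image_mem_map (m := Φ) hall
  rw [hmap] at himg
  have hline : Tendsto (fun c : ℂ => c • v) (𝓝[≠] 0) (𝓝 0) := by
    have : Tendsto (fun c : ℂ => c • v) (𝓝 0) (𝓝 ((0 : ℂ) • v)) := tendsto_id.smul_const v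
    rw [zero_smul] at this
    exact this.mono_left nhdsWithin_le_nhds
  obtain ⟨c, ⟨z, ⟨hz1, hz2, hz3⟩, hzc⟩, hc⟩ :=
    ((hline.eventually himg).and self_mem_nhdsWithin).exists
  have hza : z ≠ a := by
    rintro rfl
    rw [hΦa] at hzc
    exact smul_ne_zero hc hv0 hzc.symm
  refine hz1 hza (hfix z hz2 hz3 ?_)
  have hcv : A (c • v) = c • v := by rw [map_smul, hv]
  have h1 : z - f z = c • v - P (z - a) + P (z - f z) := by
    rw [← hzc]
    simp only [hΦ]
    abel
  have h2 : A (z - f z) = z - f z := by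
    rw [h1, map_add, map_sub, hPmem, hPmem, hcv]
  rw [← neg_sub, map_neg, h2]

/-- A nondegenerate fixed point `a` of `f` persists for the maps `z ↦ f (t • z)`, `t` near `1`. -/
lemma eventually_exists_eq_apply_smul [FiniteDimensional ℂ E] {f : E → E} {f' : E →L[ℂ] E} {a : E}
    (hf : HasStrictFDerivAt f f' a) (hfa : f a = a) (hker : ∀ v, f' v = v → v = 0)
    {U : Set E} (hU : U ∈ 𝓝 a) :
    ∀ᶠ t : ℂ in 𝓝 1, ∃ z ∈ U, f (t • z) = z := by
  have : CompleteSpace E := FiniteDimensional.complete ℂ E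
  set H : ℂ × E → ℂ × E := fun p => (p.1, p.2 - f (p.1 • p.2))
  have hsmul : HasStrictFDerivAt (fun p : ℂ × E => p.1 • p.2)
      ((1 : ℂ) • ContinuousLinearMap.snd ℂ ℂ E + (ContinuousLinearMap.fst ℂ ℂ E).smulRight a)
      ((1 : ℂ), a) :=
    HasStrictFDerivAt.smul (x := ((1 : ℂ), a)) hasStrictFDerivAt_fst hasStrictFDerivAt_snd
  have hf1 : HasStrictFDerivAt f f' ((fun p : ℂ × E => p.1 • p.2) ((1 : ℂ), a)) := by
    simpa using hf
  have hH' := (hasStrictFDerivAt_fst (𝕜 := ℂ) (p := ((1 : ℂ), a))).prodMk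
    ((hasStrictFDerivAt_snd (𝕜 := ℂ) (p := ((1 : ℂ), a))).sub (hf1.comp ((1 : ℂ), a) hsmul))
  have hmap : map H (𝓝 ((1 : ℂ), a)) = 𝓝 ((1 : ℂ), a - f ((1 : ℂ) • a)) :=
    hH'.map_nhds_eq_of_surj (by
      rw [LinearMap.range_eq_top]
      refine LinearMap.injective_iff_surjective.1 ((injective_iff_map_eq_zero _).2 ?_)
      rintro ⟨c, v⟩ hcv
      obtain ⟨h1, h2⟩ := Prod.ext_iff.1 hcv
      replace h1 : c = 0 := h1
      subst h1
      replace h2 : v - f' v = 0 := by simpa using h2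
      rw [hker v (sub_eq_zero.1 h2).symm]
      rfl)
  have himg := image_mem_map (m := H)
    (prod_mem_nhds (univ_mem : (univ : Set ℂ) ∈ 𝓝 1) hU)
  rw [hmap] at himg
  have hline : Tendsto (fun t : ℂ => (t, (0 : E))) (𝓝 1) (𝓝 ((1 : ℂ), a - f ((1 : ℂ) • a))) := by
    rw [one_smul, hfa, sub_self]
    exact (Continuous.prodMk_left (0 : E)).tendsto 1
  filter_upwards [hline.eventually himg] with t ht
  obtain ⟨⟨s, z⟩, ⟨-, hz⟩, hsz⟩ := ht
  obtain ⟨h1, h2⟩ := Prod.ext_iff.1 hsz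
  replace h1 : s = t := h1
  subst h1
  exact ⟨z, hz, (sub_eq_zero.1 h2).symm⟩

/-- For a holomorphic self-map `f` of a bounded balanced set and `0 < t < 1`, the map
`z ↦ f (t • z)` has at most one fixed point. -/
lemma eq_of_eq_apply_smul {D : Set E} {f : E → E} {M t : ℝ} {z w : E}
    (hM : ∀ z ∈ D, ‖z‖ ≤ M) (hbal : ∀ z ∈ D, ∀ c : ℂ, ‖c‖ ≤ 1 → c • z ∈ D)
    (hf : DifferentiableOn ℂ f D) (hmaps : MapsTo f D D) (ht0 : 0 < t) (ht1 : t < 1)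
    (hz : z ∈ D) (hw : w ∈ D) (hfz : f ((t : ℂ) • z) = z) (hfw : f ((t : ℂ) • w) = w) :
    z = w := by
  have key : ∀ k : ℕ, ∀ g : E → E, DifferentiableOn ℂ g D → MapsTo g D D →
      ‖g z - g w‖ ≤ t ^ k * (2 * M) := by
    intro k
    induction k with
    | zero =>
      intro g _ hgm
      linarith [norm_sub_le (g z) (g w), hM _ (hgm hz), hM _ (hgm hw)]
    | succ k ih =>
      intro g hg hgm
      have hgf : DifferentiableOn ℂ (g ∘ f) D := hg.comp hf hmaps
      have hgfm : MapsTo (g ∘ f) D D := hgm.comp hmaps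
      set h : ℂ → E := fun c => (g ∘ f) (c • z) - (g ∘ f) (c • w) with hh
      have h0 : h 0 = 0 := by simp [hh]
      have hball : ∀ u ∈ D, ∀ c ∈ ball (0 : ℂ) 1, c • u ∈ D := fun u hu c hc =>
        hbal u hu c (mem_ball_zero_iff.1 hc).le
      have hline : ∀ u ∈ D, DifferentiableOn ℂ (fun c : ℂ => (g ∘ f) (c • u)) (ball 0 1) :=
        fun u hu => hgf.comp (by fun_prop) (hball u hu)
      have hmaps' : MapsTo h (ball 0 1) (closedBall (h 0) (t ^ k * (2 * M))) := by
        intro c hc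
        have hc' : MapsTo (fun u : E => c • u) D D := fun u hu => hball u hu c hc
        rw [h0, mem_closedBall_zero_iff]
        exact ih (fun u => (g ∘ f) (c • u)) (hgf.comp (by fun_prop) hc') (hgfm.comp hc')
      have := Complex.dist_le_div_mul_dist_of_mapsTo_ball (z := (t : ℂ))
        ((hline z hz).sub (hline w hw)) hmaps' (by simpa [abs_of_pos ht0] using ht1)
      have ht : h t = g z - g w := by simp only [hh, Function.comp_apply, hfz, hfw]
      change dist (h t) (h 0) ≤ _ at this
      rw [h0, dist_zero_right, dist_zero_right, ht, Complex.norm_real, Real.norm_of_nonneg ht0.le,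
        div_one] at this
      rw [pow_succ]
      linarith
  have hlim : Tendsto (fun k : ℕ => t ^ k * (2 * M)) atTop (𝓝 0) := by
    simpa using (tendsto_pow_atTop_nhds_zero_of_lt_one ht0.le ht1).mul_const (2 * M)
  have hle : ‖z - w‖ ≤ 0 :=
    ge_of_tendsto' hlim fun k => key k id differentiableOn_id (mapsTo_id D)
  exact sub_eq_zero.1 (norm_le_zero_iff.1 hle)

end Holomorphic

theorem fixed_points_finite_of_balanced {n : ℕ} (D : Set (CSpace n))
    (hDopen : IsOpen D) (hDne : D.Nonempty) (hDbdd : Bornology.IsBounded D)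
    (hbal : ∀ z ∈ D, ∀ lam : ℂ, ‖lam‖ ≤ 1 → lam • z ∈ D)
    (f : CSpace n → CSpace n) (hf : AutOn D f)
    (hdisc : DiscreteIn (FixOn D f)) :
    (FixOn D f).Finite := by
  obtain ⟨M, hM⟩ := hDbdd.exists_norm_le
  obtain ⟨hfd, hbij, -⟩ := hf
  have hmaps : MapsTo f D D := hbij.mapsTo
  have hpersist : ∀ a ∈ FixOn D f, ∀ U ∈ 𝓝 a,
      ∀ᶠ t : ℂ in 𝓝 1, ∃ z ∈ U, f (t • z) = z := by
    rintro a ⟨haD, hfa⟩ U hU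
    refine eventually_exists_eq_apply_smul (hfd.hasStrictFDerivAt_of_norm_le hDopen haD
      fun z hz => hM _ (hmaps hz)) hfa (fun v hv => ?_) hU
    by_contra hv0
    obtain ⟨ε, hε, hiso⟩ := hdisc a ⟨haD, hfa⟩
    have hfreq := frequently_fixed_of_fderiv_apply_eq hDopen hM hfd hmaps haD hfa hv0 hv
    have hnear : ∀ᶠ z in 𝓝[≠] a, z ∈ D ∩ ball a ε ∧ z ≠ a :=
      inter_mem (nhdsWithin_le_nhds (inter_mem (hDopen.mem_nhds haD) (ball_mem_nhds a hε)))
        self_mem_nhdsWithin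
    obtain ⟨z, hfz, ⟨hzD, hzε⟩, hza⟩ := (hfreq.and_eventually hnear).exists
    exact (hiso z ⟨hzD, hfz⟩ hza).not_gt (mem_ball.1 hzε)
  refine Set.Subsingleton.finite fun a ha b hb => ?_
  by_contra hab
  obtain ⟨U, V, hU, hV, haU, hbV, hUV⟩ := t2_separation hab
  have hev := (hpersist a ha _ (inter_mem (hU.mem_nhds haU) (hDopen.mem_nhds ha.1))).and
    (hpersist b hb _ (inter_mem (hV.mem_nhds hbV) (hDopen.mem_nhds hb.1)))
  have hreal : Tendsto (fun t : ℝ => (t : ℂ)) (𝓝[<] 1) (𝓝 1) :=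
    (Complex.continuous_ofReal.tendsto 1).mono_left nhdsWithin_le_nhds
  obtain ⟨t, ⟨⟨z, ⟨hzU, hzD⟩, hfz⟩, w, ⟨hwV, hwD⟩, hfw⟩, ht0, ht1⟩ :=
    ((hreal.eventually hev).and (Ioo_mem_nhdsLT one_pos)).exists
  have hzw : z = w := eq_of_eq_apply_smul hM hbal hfd hmaps ht0 ht1 hzD hwD hfz hfw
  exact Set.disjoint_left.1 hUV hzU (hzw ▸ hwV)
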